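/- For all 0 < q < 1, 0 < a < 1, 0 < b < 1 such that b^{−1}q^{1−n−x} ≠ q^{−j} for 0 ≤ j < min(n,x), and all n, x ∈ ℕ, the little q-Jacobi function satisfies p_n^{a,b;q}(x) = q^{n(n−1)/2} (−a)^n · [(bq^x;q)_n / (a;q)_n] · ∑_{k=0}^{min(n,x)} [(q^{−n};q)_k (q^{−x};q)_k / ((b^{−1}q^{1−n−x};q)_k (q;q)_k)] · (q^{2−n}(ab)^{−1})^k. -/

import Mathlib

open Finset

/-- The q-Pochhammer symbol `(c;q)_k = ∏_{j=0}^{k-1} (1 - c q^j)`. -/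
noncomputable def qPoch (q c : ℝ) (k : ℕ) : ℝ := ∏ j ∈ Finset.range k, (1 - c * q ^ j)

/-- The little q-Jacobi function
`p_n^{a,b;q}(x) = ∑_{k=0}^{n} [(q^{−n};q)_k (a b q^{n−1};q)_k / ((a;q)_k (q;q)_k)] q^{k(x+1)}`. -/
noncomputable def littleqJacobi (a b q : ℝ) (n x : ℕ) : ℝ :=
  ∑ k ∈ Finset.range (n + 1),
    qPoch q (q ^ (-(n : ℤ))) k * qPoch q (a * b * q ^ ((n : ℤ) - 1)) k
      / (qPoch q a k * qPoch q q k) * q ^ (k * (x + 1))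


noncomputable def gB (q : ℝ) : ℕ → ℕ → ℝ
  | _, 0 => 1
  | 0, _ + 1 => 0
  | n + 1, k + 1 => gB q n k + q ^ (k + 1) * gB q n (k + 1)

lemma gB_zero (q : ℝ) (n : ℕ) : gB q n 0 = 1 := by cases n <;> simp [gB]

lemma gB_gt (q : ℝ) (n : ℕ) : ∀ k, n < k → gB q n k = 0 := by
  induction n with
  | zero => intro k hk; obtain ⟨j, rfl⟩ : ∃ j, k = j + 1 := ⟨k - 1, by omega⟩; simp [gB]
  | succ n ih =>
    intro k hk
    obtain ⟨j, rfl⟩ : ∃ j, k = j + 1 := ⟨k - 1, by omega⟩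
    rw [gB, ih j (by omega), ih (j + 1) (by omega)]; simp

lemma gB_ratio (q : ℝ) (n : ℕ) : ∀ k,
    q ^ k * (1 - q ^ (k + 1)) * gB q n (k + 1) = (q ^ k - q ^ n) * gB q n k := by
  induction n with
  | zero =>
    intro k
    cases k <;> simp [gB]
  | succ n ih =>
    intro k
    cases k with
    | zero =>
      have := ih 0
      have e : gB q (n + 1) (0 + 1) = gB q n 0 + q ^ (0 + 1) * gB q n (0 + 1) := by
        simp only [gB]
      rw [e, gB_zero, gB_zero]
      rw [gB_zero] at this
      linear_combination q * this
    | succ k =>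
      have h1 := ih k
      have h2 := ih (k + 1)
      rw [gB, gB]
      linear_combination q ^ (k + 2) * h2 + q * h1

lemma gB_pascal (q : ℝ) (n k : ℕ) :
    q ^ k * gB q (n + 1) (k + 1) = q ^ n * gB q n k + q ^ k * gB q n (k + 1) := by
  rw [gB]
  linear_combination -gB_ratio q n k

lemma gB_pascal' (q : ℝ) (hq : q ≠ 0) (n k : ℕ) (h : k ≤ n) :
    gB q (n + 1) (k + 1) = q ^ (n - k) * gB q n k + gB q n (k + 1) := by
  have := gB_pascal q n k
  obtain ⟨m, rfl⟩ := Nat.exists_eq_add_of_le h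
  have hk : q ^ k ≠ 0 := pow_ne_zero _ hq
  apply mul_left_cancel₀ hk
  rw [this, Nat.add_sub_cancel_left]; ring

lemma gB_sum (q : ℝ) (hq : q ≠ 0) (n : ℕ) (F : ℕ → ℝ) :
    ∑ k ∈ Finset.range (n + 2), gB q (n + 1) k * F k =
      ∑ k ∈ Finset.range (n + 1), gB q n k * (q ^ (n - k) * F (k + 1) + F k) := by
  have e : ∑ k ∈ Finset.range (n + 1), gB q n k * F k
      = ∑ k ∈ Finset.range (n + 2), gB q n k * F k := by
    rw [Finset.sum_range_succ _ (n + 1), gB_gt q n (n + 1) (by omega)]; simp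
  simp only [mul_add, Finset.sum_add_distrib]
  rw [e, Finset.sum_range_succ' _ (n + 1), Finset.sum_range_succ' _ (n + 1), gB_zero, gB_zero,
    ← add_assoc, ← Finset.sum_add_distrib]
  congr 1
  apply Finset.sum_congr rfl
  intro k hk
  rw [gB_pascal' q hq n k (by simp at hk; omega)]; ring

lemma qPoch_succ (q c : ℝ) (k : ℕ) : qPoch q c (k + 1) = qPoch q c k * (1 - c * q ^ k) :=
  Finset.prod_range_succ _ _

lemma qPoch_zero (q c : ℝ) : qPoch q c 0 = 1 := by simp [qPoch]

lemma qPoch_add (q c : ℝ) (k m : ℕ) :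
    qPoch q c (k + m) = qPoch q c k * qPoch q (c * q ^ k) m := by
  unfold qPoch
  rw [Finset.prod_range_add]
  congr 1
  apply Finset.prod_congr rfl
  intro j _
  ring

lemma qPoch_succ' (q c : ℝ) (k : ℕ) :
    qPoch q c (k + 1) = (1 - c) * qPoch q (c * q) k := by
  rw [add_comm, qPoch_add]; simp [qPoch]

/-- Exponent k(k-1)/2 recursively. -/
lemma ch_succ (k : ℕ) : (k + 1).choose 2 = k.choose 2 + k := by
  rw [Nat.choose_succ_succ' k 1]; simp [add_comm]

noncomputable def RR (q : ℝ) (n : ℕ) (a b y : ℝ) : ℝ :=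
  ∑ k ∈ Finset.range (n + 1), gB q n k *
    ((-a) ^ (n - k) * q ^ ((n - k).choose 2) * qPoch q (b * y) (n - k) * qPoch q⁻¹ y k)

noncomputable def LL (q : ℝ) (n : ℕ) (a b y : ℝ) : ℝ :=
  ∑ k ∈ Finset.range (n + 1), gB q n k *
    ((-1) ^ k * q ^ (k.choose 2) * (q * y * q⁻¹ ^ n) ^ k * qPoch q (a * b * q⁻¹ * q ^ n) k *
      qPoch q (a * q ^ k) (n - k))

lemma RR_succ (q : ℝ) (hq : q ≠ 0) (n : ℕ) (a b y : ℝ) :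
    RR q (n + 1) a b y = (1 - y) * RR q n (a * q) (b * q) (y * q⁻¹)
      - a * (1 - b * y) * RR q n (a * q) (b * q) y := by
  unfold RR
  rw [gB_sum q hq, Finset.mul_sum, Finset.mul_sum, ← Finset.sum_sub_distrib]
  apply Finset.sum_congr rfl
  intro k hk
  obtain ⟨m, rfl⟩ := Nat.exists_eq_add_of_le (show k ≤ n by simp at hk; omega)
  have e1 : k + m - k = m := by omega
  have e2 : k + m + 1 - (k + 1) = m := by omega
  have e3 : k + m + 1 - k = m + 1 := by omega
  have e4 : b * q * (y * q⁻¹) = b * y := by field_simp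
  have e5 : b * q * y = b * y * q := by ring
  rw [e1, e2, e3, e4, e5, qPoch_succ' q⁻¹ y k, qPoch_succ' q (b * y) m, ch_succ]
  ring

lemma LL_succ (q : ℝ) (hq : q ≠ 0) (n : ℕ) (a b y : ℝ) :
    LL q (n + 1) a b y = (1 - y) * LL q n (a * q) (b * q) (y * q⁻¹)
      - a * (1 - b * y) * LL q n (a * q) (b * q) y := by
  have key : (1 - y) * LL q n (a * q) (b * q) (y * q⁻¹)
      - a * (1 - b * y) * LL q n (a * q) (b * q) y =
      ∑ k ∈ Finset.range (n + 1), gB q n k * ((-1) ^ k * q ^ (k.choose 2) * (y * q⁻¹ ^ n) ^ k *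
        qPoch q (a * b * q ^ n * q) k * qPoch q (a * q ^ k) (n + 1 - k))
      - ∑ k ∈ Finset.range (n + 1), gB q n k * ((-1) ^ k * q ^ (k.choose 2) * (y * q⁻¹ ^ n) ^ k *
        qPoch q (a * b * q ^ n * q) k * qPoch q (a * q ^ (k + 1)) (n - k) *
          (y * (1 - a * b * q ^ k))) := by
    unfold LL
    rw [Finset.mul_sum, Finset.mul_sum, ← Finset.sum_sub_distrib, ← Finset.sum_sub_distrib]
    apply Finset.sum_congr rfl
    intro k hk
    obtain ⟨m, rfl⟩ := Nat.exists_eq_add_of_le (show k ≤ n by simp at hk; omega)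
    have e1 : k + m - k = m := by omega
    have e3 : k + m + 1 - k = m + 1 := by omega
    have e4 : a * q * (b * q) * q⁻¹ * q ^ (k + m) = a * b * q ^ (k + m) * q := by field_simp
    have e5 : a * q * q ^ k = a * q ^ (k + 1) := by ring
    have e6 : a * q ^ k * q = a * q ^ (k + 1) := by ring
    have e7 : q * (y * q⁻¹) * q⁻¹ ^ (k + m) = y * q⁻¹ ^ (k + m) := by field_simp
    have e8 : q * y * q⁻¹ ^ (k + m) = q * (y * q⁻¹ ^ (k + m)) := by ring
    rw [e1, e3, e4, e5, e7, e8, qPoch_succ' q (a * q ^ k) m, e6, mul_pow q]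
    ring
  rw [key]
  have ext : ∀ F : ℕ → ℝ, ∑ k ∈ Finset.range (n + 1), gB q n k * F k
      = ∑ k ∈ Finset.range (n + 2), gB q n k * F k := by
    intro F
    rw [Finset.sum_range_succ _ (n + 1), gB_gt q n (n + 1) (by omega)]; simp
  rw [ext (fun k => ((-1) ^ k * q ^ (k.choose 2) * (y * q⁻¹ ^ n) ^ k *
        qPoch q (a * b * q ^ n * q) k * qPoch q (a * q ^ k) (n + 1 - k)))]
  unfold LL
  rw [Finset.sum_range_succ' _ (n + 1), Finset.sum_range_succ' _ (n + 1), add_sub_right_comm,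
    ← Finset.sum_sub_distrib]
  congr 1
  swap
  · simp [gB_zero, qPoch_zero]
  apply Finset.sum_congr rfl
  intro k hk
  obtain ⟨m, rfl⟩ := Nat.exists_eq_add_of_le (show k ≤ n by simp at hk; omega)
  have e1 : k + m - k = m := by omega
  have e2 : k + m + 1 - (k + 1) = m := by omega
  have e4 : a * b * q⁻¹ * q ^ (k + m + 1) = a * b * q ^ (k + m) := by field_simp; ring
  have e7 : q * y * q⁻¹ ^ (k + m + 1) = y * q⁻¹ ^ (k + m) := by
    linear_combination (y * q⁻¹ ^ (k + m)) * mul_inv_cancel₀ hq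
  rw [e1, e2, e4, e7, qPoch_succ' q (a * b * q ^ (k + m)) k,
    qPoch_succ q (a * b * q ^ (k + m) * q) k, ch_succ]
  have h1 : gB q (k + m + 1) (k + 1) = gB q (k + m) k + q ^ (k + 1) * gB q (k + m) (k + 1) := by
    rw [gB]
  have h2 := gB_pascal' q hq (k + m) k (by omega)
  rw [e1] at h2
  have hr : q ^ k * (y * q⁻¹ ^ (k + m)) * q ^ m = y := by
    simp only [inv_pow]; field_simp; ring
  set z := y * q⁻¹ ^ (k + m) with hz
  have hy : y = q ^ k * z * q ^ m := hr.symm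
  rw [hy]
  clear_value z
  set G := gB q (k + m + 1) (k + 1)
  set W := (-1 : ℝ) ^ k * q ^ (k.choose 2) * z ^ k * qPoch q (a * b * q ^ (k + m) * q) k
    * qPoch q (a * q ^ (k + 1)) m with hW
  linear_combination (-(W * q ^ k * z)) * h2 + (W * q ^ k * z * (a * b * q ^ (k + m))) * h1

lemma LL_eq_RR (q : ℝ) (hq : q ≠ 0) (n : ℕ) : ∀ a b y : ℝ, LL q n a b y = RR q n a b y := by
  induction n with
  | zero => intro a b y; simp [LL, RR, qPoch]
  | succ n ih =>
    intro a b y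
    rw [LL_succ q hq, RR_succ q hq, ih, ih]

lemma qPoch_neg_n (q : ℝ) (hq : q ≠ 0) (n k : ℕ) :
    qPoch q (q ^ (-(n : ℤ))) k =
      gB q n k * qPoch q q k * ((-1) ^ k * q ^ (k.choose 2) * (q⁻¹ ^ n) ^ k) := by
  induction k with
  | zero => simp [gB_zero, qPoch]
  | succ k ih =>
    have h := gB_ratio q n k
    have e : q ^ (-(n : ℤ)) = q⁻¹ ^ n := by simp
    rw [qPoch_succ, ih, qPoch_succ q q, ch_succ, e]
    have hr : q⁻¹ ^ n * q ^ n = 1 := by rw [← mul_pow, inv_mul_cancel₀ hq, one_pow]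
    set r := q⁻¹ ^ n
    linear_combination (qPoch q q k * ((-1) ^ k * q ^ (k.choose 2) * r ^ k)) *
      (r * h - gB q n k * hr)

lemma qPoch_neg_x (q y : ℝ) (hq : q ≠ 0) (hy : y ≠ 0) (k : ℕ) :
    qPoch q y⁻¹ k = (-1) ^ k * q ^ (k.choose 2) * y⁻¹ ^ k * qPoch q⁻¹ y k := by
  induction k with
  | zero => simp [qPoch]
  | succ k ih =>
    rw [qPoch_succ, ih, qPoch_succ, ch_succ]
    have hr : q⁻¹ ^ k * q ^ k = 1 := by rw [← mul_pow, inv_mul_cancel₀ hq, one_pow]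
    have hr' : y⁻¹ * y = 1 := inv_mul_cancel₀ hy
    set r := q⁻¹ ^ k
    set w := y⁻¹
    linear_combination (-((-1) ^ k * q ^ (k.choose 2) * w ^ k * qPoch q⁻¹ y k)) *
      (hr' * r * q ^ k + hr)

lemma qPoch_den (q c : ℝ) (hq : q ≠ 0) (hc : c ≠ 0) (m k : ℕ) :
    qPoch q (c⁻¹ * q * q⁻¹ ^ (k + m)) k * qPoch q c m =
      (-1) ^ k * q ^ k * (q⁻¹ ^ (k + m)) ^ k * q ^ (k.choose 2) * c⁻¹ ^ k * qPoch q c (k + m) := by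
  induction k with
  | zero => simp [qPoch]
  | succ k ih =>
    have e : c⁻¹ * q * q⁻¹ ^ (k + 1 + m) * q = c⁻¹ * q * q⁻¹ ^ (k + m) := by
      linear_combination (c⁻¹ * q * q⁻¹ ^ (k + m)) * mul_inv_cancel₀ hq
    have e1 : k + 1 + m = k + m + 1 := by omega
    rw [qPoch_succ', e, mul_assoc, ih, e1, qPoch_succ q c, ch_succ]
    have hr : q⁻¹ ^ (k + m) * q ^ (k + m) = 1 := by
      rw [← mul_pow, inv_mul_cancel₀ hq, one_pow]
    have hr' : c⁻¹ * c = 1 := inv_mul_cancel₀ hc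
    have h1 : q * q⁻¹ ^ (k + m + 1) = q⁻¹ ^ (k + m) := by
      linear_combination (q⁻¹ ^ (k + m)) * mul_inv_cancel₀ hq
    have h3 : (q⁻¹ ^ (k + m + 1)) ^ (k + 1) * q ^ (k + 1) = (q⁻¹ ^ (k + m)) ^ (k + 1) := by
      rw [← mul_pow, mul_comm _ q, h1]
    have h2 : c⁻¹ * q * q⁻¹ ^ (k + m + 1) = c⁻¹ * q⁻¹ ^ (k + m) := by rw [mul_assoc, h1]
    rw [h2]
    have h4 : (-1 : ℝ) ^ (k + 1) * q ^ (k + 1) * (q⁻¹ ^ (k + m + 1)) ^ (k + 1) *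
        q ^ (k.choose 2 + k) * c⁻¹ ^ (k + 1) * (qPoch q c (k + m) * (1 - c * q ^ (k + m)))
        = (-1 : ℝ) ^ (k + 1) * (q⁻¹ ^ (k + m)) ^ (k + 1) *
        q ^ (k.choose 2 + k) * c⁻¹ ^ (k + 1) * (qPoch q c (k + m) * (1 - c * q ^ (k + m))) := by
      rw [← h3]; ring
    rw [h4]
    set r := q⁻¹ ^ (k + m)
    set w := c⁻¹
    linear_combination (-((-1) ^ k * q ^ k * r ^ k * q ^ (k.choose 2) * w ^ k *
      qPoch q c (k + m))) * (hr + r * q ^ (k + m) * hr')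

lemma qPoch_pos (q c : ℝ) (hq0 : 0 < q) (hq1 : q < 1) (hc1 : c < 1) (hc0 : 0 < c)
    (k : ℕ) : 0 < qPoch q c k := by
  apply Finset.prod_pos
  intro j _
  have : q ^ j ≤ 1 := pow_le_one₀ hq0.le hq1.le
  have : 0 < q ^ j := pow_pos hq0 j
  nlinarith

lemma ch_add (k m : ℕ) : (k + m).choose 2 + k.choose 2 + k = m.choose 2 + (k + m) * k := by
  induction k with
  | zero => simp
  | succ k ih =>
    rw [show k + 1 + m = k + m + 1 by ring, ch_succ, ch_succ]
    nlinarith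

theorem littleqJacobi_2phi1_inverted (q a b : ℝ) (hq0 : 0 < q) (hq1 : q < 1)
    (ha0 : 0 < a) (ha1 : a < 1) (hb0 : 0 < b) (hb1 : b < 1) (n x : ℕ)
    (hbq : ∀ j < min n x, b⁻¹ * q ^ (1 - (n : ℤ) - (x : ℤ)) ≠ q ^ (-(j : ℤ))) :
    littleqJacobi a b q n x =
      q ^ (n * (n - 1) / 2) * (-a) ^ n * (qPoch q (b * q ^ x) n / qPoch q a n) *
        ∑ k ∈ Finset.range (min n x + 1),
          qPoch q (q ^ (-(n : ℤ))) k * qPoch q (q ^ (-(x : ℤ))) k /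
            (qPoch q (b⁻¹ * q ^ (1 - (n : ℤ) - (x : ℤ))) k * qPoch q q k) *
            (q ^ (2 - (n : ℤ)) * (a * b)⁻¹) ^ k := by
  have hq : q ≠ 0 := hq0.ne'
  have hA : ∀ k, qPoch q a k ≠ 0 := fun k => (qPoch_pos q a hq0 hq1 ha1 ha0 k).ne'
  have hQ : ∀ k, qPoch q q k ≠ 0 := fun k => (qPoch_pos q q hq0 hq1 hq1 hq0 k).ne'
  have hy : q ^ x ≠ 0 := pow_ne_zero _ hq
  have hL : littleqJacobi a b q n x = LL q n a b (q ^ x) / qPoch q a n := by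
    unfold littleqJacobi LL
    rw [Finset.sum_div]
    apply Finset.sum_congr rfl
    intro k hk
    obtain ⟨m, rfl⟩ := Nat.exists_eq_add_of_le (show k ≤ n by simp at hk; omega)
    have e1 : k + m - k = m := by omega
    have e2 : a * b * q ^ (((k + m : ℕ) : ℤ) - 1) = a * b * q⁻¹ * q ^ (k + m) := by
      rw [zpow_sub₀ hq, zpow_natCast, zpow_one]; field_simp
    have h3 : qPoch q (a * q ^ k) m ≠ 0 := by
      intro h
      apply hA (k + m)
      rw [qPoch_add, h, mul_zero]
    have e4 : q ^ (k * (x + 1)) = (q ^ x * q) ^ k := by rw [← pow_succ, ← pow_mul, mul_comm]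
    rw [e1, e2, qPoch_neg_n q hq, qPoch_add q a k m, e4]
    have := hA k
    have := hQ k
    rw [mul_pow (q * q ^ x), mul_comm q (q ^ x)]
    generalize (q ^ x * q) ^ k = u
    generalize (q⁻¹ ^ (k + m)) ^ k = v
    generalize qPoch q (a * b * q⁻¹ * q ^ (k + m)) k = w
    field_simp
  have hsum : ∑ k ∈ Finset.range (min n x + 1),
          qPoch q (q ^ (-(n : ℤ))) k * qPoch q (q ^ (-(x : ℤ))) k /
            (qPoch q (b⁻¹ * q ^ (1 - (n : ℤ) - (x : ℤ))) k * qPoch q q k) *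
            (q ^ (2 - (n : ℤ)) * (a * b)⁻¹) ^ k
      = ∑ k ∈ Finset.range (n + 1),
          qPoch q (q ^ (-(n : ℤ))) k * qPoch q (q ^ (-(x : ℤ))) k /
            (qPoch q (b⁻¹ * q ^ (1 - (n : ℤ) - (x : ℤ))) k * qPoch q q k) *
            (q ^ (2 - (n : ℤ)) * (a * b)⁻¹) ^ k := by
    apply Finset.sum_subset
    · intro k hk
      simp only [Finset.mem_range] at *
      omega
    · intro k hk hk'
      simp only [Finset.mem_range] at *
      have : qPoch q (q ^ (-(x : ℤ))) k = 0 := by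
        apply Finset.prod_eq_zero (i := x)
        · simp only [Finset.mem_range]; omega
        · rw [zpow_neg, zpow_natCast, inv_mul_cancel₀ hy, sub_self]
      rw [this]; simp
  have hc0 : 0 < b * q ^ x := mul_pos hb0 (pow_pos hq0 x)
  have hc1 : b * q ^ x < 1 := by
    have : q ^ x ≤ 1 := pow_le_one₀ hq0.le hq1.le
    nlinarith
  have hC : ∀ k, qPoch q (b * q ^ x) k ≠ 0 :=
    fun k => (qPoch_pos q _ hq0 hq1 hc1 hc0 k).ne'
  have hR : RR q n a b (q ^ x) = q ^ (n * (n - 1) / 2) * (-a) ^ n * qPoch q (b * q ^ x) n *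
      ∑ k ∈ Finset.range (n + 1),
          qPoch q (q ^ (-(n : ℤ))) k * qPoch q (q ^ (-(x : ℤ))) k /
            (qPoch q (b⁻¹ * q ^ (1 - (n : ℤ) - (x : ℤ))) k * qPoch q q k) *
            (q ^ (2 - (n : ℤ)) * (a * b)⁻¹) ^ k := by
    unfold RR
    rw [Finset.mul_sum, ← Nat.choose_two_right]
    apply Finset.sum_congr rfl
    intro k hk
    obtain ⟨m, rfl⟩ := Nat.exists_eq_add_of_le (show k ≤ n by simp at hk; omega)
    have e1 : k + m - k = m := by omega
    have e2 : b⁻¹ * q ^ (1 - ((k + m : ℕ) : ℤ) - (x : ℤ))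
        = (b * q ^ x)⁻¹ * q * q⁻¹ ^ (k + m) := by
      rw [zpow_sub₀ hq, zpow_sub₀ hq, zpow_natCast, zpow_natCast, zpow_one, inv_pow]; field_simp
    have e3 : q ^ (2 - ((k + m : ℕ) : ℤ)) = q ^ 2 * q⁻¹ ^ (k + m) := by
      rw [zpow_sub₀ hq, zpow_natCast, inv_pow]; rfl
    have e4 : q ^ (-(x : ℤ)) = (q ^ x)⁻¹ := by rw [zpow_neg, zpow_natCast]
    have hD := qPoch_den q (b * q ^ x) hq hc0.ne' m k
    have e5 : qPoch q ((b * q ^ x)⁻¹ * q * q⁻¹ ^ (k + m)) k = _ :=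
      eq_div_of_mul_eq (hC m) hD
    rw [e1, e2, e3, e4, qPoch_neg_n q hq, qPoch_neg_x q (q ^ x) hq hy, e5]
    have h1 := hC m
    have h2 := hC (k + m)
    have h3 := hQ k
    have hch : q ^ ((k + m).choose 2) * q ^ (k.choose 2) * q ^ k
        = q ^ (m.choose 2) * (q ^ (k + m)) ^ k := by
      rw [← pow_mul, ← pow_add, ← pow_add, ← pow_add, ch_add]
    have hs : (-1 : ℝ) ^ k ≠ 0 := pow_ne_zero _ (by norm_num)
    have ha := ha0.ne'
    have hb := hb0.ne'
    have hv : q ^ (k + m) ≠ 0 := pow_ne_zero _ hq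
    have hv' : q ^ (k.choose 2) ≠ 0 := pow_ne_zero _ hq
    have hna : (-a) ^ (k + m) = (-a) ^ m * ((-1) ^ k * a ^ k) := by
      rw [← mul_pow, neg_one_mul, pow_add, mul_comm]
    have hss : (-1 : ℝ) ^ k * (-1) ^ k = 1 := by rw [← mul_pow]; norm_num
    rw [hna]
    simp only [inv_pow, mul_pow, mul_inv]
    generalize (-1 : ℝ) ^ k = s at *
    generalize qPoch q⁻¹ (q ^ x) k = Y at *
    generalize qPoch q (b * q ^ x) m = C1 at *
    generalize qPoch q (b * q ^ x) (k + m) = C2 at *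
    generalize gB q (k + m) k = G at *
    generalize q ^ (k + m) = v at *
    generalize q ^ x = y at *
    generalize (-a) ^ m = am at *
    generalize q ^ ((k + m).choose 2) = A1 at *
    generalize q ^ (k.choose 2) = A2 at *
    generalize q ^ (m.choose 2) = A3 at *
    rw [show (q ^ 2) ^ k = q ^ k * q ^ k by rw [← pow_mul, ← pow_add]; ring_nf]
    have hqk : q ^ k ≠ 0 := pow_ne_zero _ hq
    generalize q ^ k = u at *
    have hvk : v ^ k ≠ 0 := pow_ne_zero _ hv
    generalize v ^ k = w at *
    have hyk : y ^ k ≠ 0 := pow_ne_zero _ hy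
    generalize y ^ k = yk at *
    have hak : a ^ k ≠ 0 := pow_ne_zero _ ha
    generalize a ^ k = ak at *
    have hbk : b ^ k ≠ 0 := pow_ne_zero _ hb
    generalize b ^ k = bk at *
    field_simp
    have hs2 : s ^ 2 = 1 := by rw [sq, hss]
    simp only [hs2, mul_one]
    linear_combination (-(G * am * Y)) * hch
  have hc0 : 0 < b * q ^ x := mul_pos hb0 (pow_pos hq0 x)
  have hc1 : b * q ^ x < 1 := by
    have : q ^ x ≤ 1 := pow_le_one₀ hq0.le hq1.le
    nlinarith
  have hC : ∀ k, qPoch q (b * q ^ x) k ≠ 0 :=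
    fun k => (qPoch_pos q _ hq0 hq1 hc1 hc0 k).ne'
  have hR : RR q n a b (q ^ x) = q ^ (n * (n - 1) / 2) * (-a) ^ n * qPoch q (b * q ^ x) n *
      ∑ k ∈ Finset.range (n + 1),
          qPoch q (q ^ (-(n : ℤ))) k * qPoch q (q ^ (-(x : ℤ))) k /
            (qPoch q (b⁻¹ * q ^ (1 - (n : ℤ) - (x : ℤ))) k * qPoch q q k) *
            (q ^ (2 - (n : ℤ)) * (a * b)⁻¹) ^ k := by
    unfold RR
    rw [Finset.mul_sum, ← Nat.choose_two_right]
    apply Finset.sum_congr rfl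
    intro k hk
    obtain ⟨m, rfl⟩ := Nat.exists_eq_add_of_le (show k ≤ n by simp at hk; omega)
    have e1 : k + m - k = m := by omega
    have e2 : b⁻¹ * q ^ (1 - ((k + m : ℕ) : ℤ) - (x : ℤ))
        = (b * q ^ x)⁻¹ * q * q⁻¹ ^ (k + m) := by
      rw [zpow_sub₀ hq, zpow_sub₀ hq, zpow_natCast, zpow_natCast, zpow_one, inv_pow]; field_simp
    have e3 : q ^ (2 - ((k + m : ℕ) : ℤ)) = q ^ 2 * q⁻¹ ^ (k + m) := by
      rw [zpow_sub₀ hq, zpow_natCast, inv_pow]; rfl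
    have e4 : q ^ (-(x : ℤ)) = (q ^ x)⁻¹ := by rw [zpow_neg, zpow_natCast]
    have hD := qPoch_den q (b * q ^ x) hq hc0.ne' m k
    have e5 : qPoch q ((b * q ^ x)⁻¹ * q * q⁻¹ ^ (k + m)) k = _ :=
      eq_div_of_mul_eq (hC m) hD
    rw [e1, e2, e3, e4, qPoch_neg_n q hq, qPoch_neg_x q (q ^ x) hq hy, e5]
    have h1 := hC m
    have h2 := hC (k + m)
    have h3 := hQ k
    have hch : q ^ ((k + m).choose 2) * q ^ (k.choose 2) * q ^ k
        = q ^ (m.choose 2) * (q ^ (k + m)) ^ k := by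
      rw [← pow_mul, ← pow_add, ← pow_add, ← pow_add, ch_add]
    have hs : (-1 : ℝ) ^ k ≠ 0 := pow_ne_zero _ (by norm_num)
    have ha := ha0.ne'
    have hb := hb0.ne'
    have hv : q ^ (k + m) ≠ 0 := pow_ne_zero _ hq
    have hv' : q ^ (k.choose 2) ≠ 0 := pow_ne_zero _ hq
    have hna : (-a) ^ (k + m) = (-a) ^ m * ((-1) ^ k * a ^ k) := by
      rw [← mul_pow, neg_one_mul, pow_add, mul_comm]
    have hss : (-1 : ℝ) ^ k * (-1) ^ k = 1 := by rw [← mul_pow]; norm_num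
    rw [hna]
    simp only [inv_pow, mul_pow, mul_inv]
    generalize (-1 : ℝ) ^ k = s at *
    generalize qPoch q⁻¹ (q ^ x) k = Y at *
    generalize qPoch q (b * q ^ x) m = C1 at *
    generalize qPoch q (b * q ^ x) (k + m) = C2 at *
    generalize gB q (k + m) k = G at *
    generalize q ^ (k + m) = v at *
    generalize q ^ x = y at *
    generalize (-a) ^ m = am at *
    generalize q ^ ((k + m).choose 2) = A1 at *
    generalize q ^ (k.choose 2) = A2 at *
    generalize q ^ (m.choose 2) = A3 at *
    rw [show (q ^ 2) ^ k = q ^ k * q ^ k by rw [← pow_mul, ← pow_add]; ring_nf]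
    have hqk : q ^ k ≠ 0 := pow_ne_zero _ hq
    generalize q ^ k = u at *
    have hvk : v ^ k ≠ 0 := pow_ne_zero _ hv
    generalize v ^ k = w at *
    have hyk : y ^ k ≠ 0 := pow_ne_zero _ hy
    generalize y ^ k = yk at *
    have hak : a ^ k ≠ 0 := pow_ne_zero _ ha
    generalize a ^ k = ak at *
    have hbk : b ^ k ≠ 0 := pow_ne_zero _ hb
    generalize b ^ k = bk at *
    field_simp
    have hs2 : s ^ 2 = 1 := by rw [sq, hss]
    simp only [hs2, mul_one]
    linear_combination (-(G * am * Y)) * hch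
  rw [hL, LL_eq_RR q hq, hsum, hR]
  ring
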